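/- arXiv:hep-th/0612172 — 10 statements merged into one kernel-verified Lean document; each statement's English description precedes it below -/
import Mathlib

section
/- Let n, m, k be integers with −n ≤ k ≤ −m. For every γ ∈ ℂ with γ ≠ 0 and all w₁, w₂ ∈ ℂ, set β = γ⁻¹, v₁ = γ^(−n)·w₁ and v₂ = γ^(−m)·w₂ + γ^k·w₁ (the transition functions of an O(n) ⊕ O(m) bundle over ℙ¹ perturbed by the term ∂_{w₁}E(γ,w₁) = γ^k w₁). Define new coordinates w̃₁ = w₁ + γ^(−m−k)·w₂, w̃₂ = w₂, ṽ₁ = v₂, ṽ₂ = −v₁ + β^(n+k)·v₂. Then ṽ₁ = γ^k·w̃₁ and ṽ₂ = γ^(−n−m−k)·w̃₂; that is, in the new coordinates the transition functions are exactly those of the unperturbed bundle O(−k) ⊕ O(n+m+k). -/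
/-- Ferrari's bundle-changing coordinate transformation: for `-n ≤ k ≤ -m`, the
perturbed `O(n) ⊕ O(m)` transition functions become, in the new coordinates, the
unperturbed transition functions of `O(-k) ⊕ O(n+m+k)`. -/
theorem stmt_0 (n m k : ℤ) (h₁ : -n ≤ k) (h₂ : k ≤ -m)
    (γ w₁ w₂ : ℂ) (hγ : γ ≠ 0) :
    let β : ℂ := γ⁻¹
    let v₁ : ℂ := γ ^ (-n) * w₁
    let v₂ : ℂ := γ ^ (-m) * w₂ + γ ^ k * w₁
    let w₁' : ℂ := w₁ + γ ^ (-m - k) * w₂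
    let w₂' : ℂ := w₂
    let v₁' : ℂ := v₂
    let v₂' : ℂ := -v₁ + β ^ (n + k) * v₂
    v₁' = γ ^ k * w₁' ∧ v₂' = γ ^ (-n - m - k) * w₂' := by
  intro β v₁ v₂ w₁' w₂' v₁' v₂'
  have e₁ : γ ^ (-m) = γ ^ k * γ ^ (-m - k) := by
    rw [← zpow_add₀ hγ]; congr 1; ring
  have e₂ : β ^ (n + k) * γ ^ (-m) = γ ^ (-n - m - k) := by
    rw [inv_zpow', ← zpow_add₀ hγ]; congr 1; ring
  have e₃ : β ^ (n + k) * γ ^ k = γ ^ (-n) := by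
    rw [inv_zpow', ← zpow_add₀ hγ]; congr 1; ring
  constructor
  · change γ ^ (-m) * w₂ + γ ^ k * w₁ = γ ^ k * (w₁ + γ ^ (-m - k) * w₂)
    linear_combination w₂ * e₁
  · change -(γ ^ (-n) * w₁) + β ^ (n + k) * (γ ^ (-m) * w₂ + γ ^ k * w₁)
      = γ ^ (-n - m - k) * w₂
    linear_combination w₂ * e₂ + w₁ * e₃
end

section
/- Fix an integer k ≥ 1. For γ ∈ ℂ, γ ≠ 0 and w₁, w₂ ∈ ℂ, set β = γ⁻¹, v₁ = γ⁻¹w₁, v₂ = γ³w₂ + γ²w₁^k + w₁. Define y₁ = v₂, y₂ = βv₂ − v₁, y₃ = β²v₂ − βv₁, and ỹ₄ = βv₂^k − β³v₂ + β²v₁. Then: (i) y₂ = γ²w₂ + γw₁^k and y₃ = γw₂ + w₁^k; (ii) there is a polynomial Q ∈ ℂ[γ, w₁, w₂] with γ·Q = (γ³w₂ + γ²w₁^k + w₁)^k − w₁^k, and ỹ₄ = Q − w₂, so all four functions are regular in both coordinate charts; (iii) they satisfy the relation y₂·ỹ₄ + y₃·(y₃ − y₁^k) = 0, i.e. setting X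 = y₂, Y = ỹ₄, Z = y₁, T = y₃ the blow-down satisfies XY − T(Z^k − T) = 0, the equation of the A_k (length 1) threefold singularity. -/
/-- Blow-down of Ferrari's resolved geometry for the Intriligator–Wecht `A_k`
superpotential `W(x,y) = x^{k+1}/(k+1) + y²/2`: the global holomorphic functions
`y₁, y₂, y₃, ỹ₄` are regular in both charts (with `ỹ₄ = Q − w₂` for a polynomial
`Q` with `γ·Q = (γ³w₂+γ²w₁^k+w₁)^k − w₁^k`) and satisfy
`y₂ỹ₄ + y₃(y₃ − y₁^k) = 0`, i.e. `XY − T(Z^k − T) = 0`, the `A_k` (length 1)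
threefold singularity. -/
theorem stmt_4 (k : ℕ) (hk : 1 ≤ k) :
    ∃ Q : MvPolynomial (Fin 3) ℂ,
      (MvPolynomial.X 0 * Q
          = (MvPolynomial.X 0 ^ 3 * MvPolynomial.X 2
                + MvPolynomial.X 0 ^ 2 * MvPolynomial.X 1 ^ k + MvPolynomial.X 1) ^ k
              - MvPolynomial.X 1 ^ k) ∧
      ∀ γ w₁ w₂ : ℂ, γ ≠ 0 →
        let β : ℂ := γ⁻¹
        let v₁ : ℂ := γ⁻¹ * w₁
        let v₂ : ℂ := γ ^ 3 * w₂ + γ ^ 2 * w₁ ^ k + w₁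
        let y₁ : ℂ := v₂
        let y₂ : ℂ := β * v₂ - v₁
        let y₃ : ℂ := β ^ 2 * v₂ - β * v₁
        let y₄ : ℂ := β * v₂ ^ k - β ^ 3 * v₂ + β ^ 2 * v₁
        y₂ = γ ^ 2 * w₂ + γ * w₁ ^ k ∧
        y₃ = γ * w₂ + w₁ ^ k ∧
        y₄ = MvPolynomial.eval ![γ, w₁, w₂] Q - w₂ ∧
        y₂ * y₄ + y₃ * (y₃ - y₁ ^ k) = 0 := by
  obtain ⟨Q, hQ⟩ : (MvPolynomial.X 0 : MvPolynomial (Fin 3) ℂ) ∣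
      (MvPolynomial.X 0 ^ 3 * MvPolynomial.X 2
          + MvPolynomial.X 0 ^ 2 * MvPolynomial.X 1 ^ k + MvPolynomial.X 1) ^ k
        - MvPolynomial.X 1 ^ k := by
    refine Dvd.dvd.trans ?_ (sub_dvd_pow_sub_pow _ _ k)
    exact ⟨MvPolynomial.X 0 ^ 2 * MvPolynomial.X 2
      + MvPolynomial.X 0 * MvPolynomial.X 1 ^ k, by ring⟩
  refine ⟨Q, hQ.symm, fun γ w₁ w₂ hγ => ?_⟩
  have hev : (γ ^ 3 * w₂ + γ ^ 2 * w₁ ^ k + w₁) ^ k - w₁ ^ k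
      = γ * MvPolynomial.eval ![γ, w₁, w₂] Q := by
    simpa using congrArg (MvPolynomial.eval ![γ, w₁, w₂]) hQ
  intro β v₁ v₂ y₁ y₂ y₃ y₄
  have hβ : β * γ = 1 := inv_mul_cancel₀ hγ
  have hv₁ : v₁ = β * w₁ := rfl
  have hv₂ : v₂ = γ ^ 3 * w₂ + γ ^ 2 * w₁ ^ k + w₁ := rfl
  have hpow : v₂ ^ k = w₁ ^ k + γ * MvPolynomial.eval ![γ, w₁, w₂] Q := by
    rw [← hev]; ring
  have h₂ : y₂ = γ ^ 2 * w₂ + γ * w₁ ^ k := by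
    change β * v₂ - v₁ = _
    rw [hv₁, hv₂]
    linear_combination (γ ^ 2 * w₂ + γ * w₁ ^ k) * hβ
  have h₃ : y₃ = γ * w₂ + w₁ ^ k := by
    have : y₃ = β * y₂ := by
      change β ^ 2 * v₂ - β * v₁ = β * (β * v₂ - v₁)
      ring
    rw [this, h₂]
    linear_combination (γ * w₂ + w₁ ^ k) * hβ
  have h₄ : y₄ = MvPolynomial.eval ![γ, w₁, w₂] Q - w₂ := by
    have : y₄ = β * (v₂ ^ k - y₃) := by
      change β * v₂ ^ k - β ^ 3 * v₂ + β ^ 2 * v₁ = β * (v₂ ^ k - (β ^ 2 * v₂ - β * v₁))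
      ring
    rw [this, h₃, hpow]
    linear_combination (MvPolynomial.eval ![γ, w₁, w₂] Q - w₂) * hβ
  refine ⟨h₂, h₃, h₄, ?_⟩
  change y₂ * y₄ + y₃ * (y₃ - v₂ ^ k) = 0
  rw [h₂, h₃, h₄, hpow]
  ring
end

section
/- Fix an even integer k ≥ 2. For γ ∈ ℂ, γ ≠ 0 and w₁, w₂ ∈ ℂ, set β = γ⁻¹, v₁ = γ⁻¹w₁, v₂ = γ³w₂ + γ²w₁^k + w₁². Define Z = v₂, T = β²v₂ − v₁², Y = β·(Z^{k/2} − T), X = v₁·(Z^{k/2} − T). Then: (i) T = γw₂ + w₁^k; (ii) γ divides Z^{k/2} − T as a polynomial in ℂ[γ, w₁, w₂], so that Y = γ⁻¹(Z^{k/2} − T) and X = γ⁻¹w₁(Z^{k/2} − T) are regular in both coordinate charts; (iii) the relation X² − ZY² + T·(Z^{k/2} − T)² = 0 holds, the equation of the D_{k+2} (length 2) threefold singularity for k even. -/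
/-- Blow-down of Ferrari's resolved geometry for the Intriligator–Wecht
`D_{k+2}` superpotential (`k` even): the global holomorphic functions
`Z, T, Y, X` are regular in both charts (`γ` divides `Z^{k/2} − T` as a
polynomial) and satisfy `X² − ZY² + T(Z^{k/2} − T)² = 0`, the `D_{k+2}`
(length 2) threefold singularity for `k` even. -/
theorem stmt_5 (k : ℕ) (hk : 2 ≤ k) (hke : Even k) :
    ((MvPolynomial.X 0 : MvPolynomial (Fin 3) ℂ) ∣
        (MvPolynomial.X 0 ^ 3 * MvPolynomial.X 2
              + MvPolynomial.X 0 ^ 2 * MvPolynomial.X 1 ^ k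
              + MvPolynomial.X 1 ^ 2) ^ (k / 2)
          - (MvPolynomial.X 0 * MvPolynomial.X 2 + MvPolynomial.X 1 ^ k)) ∧
    ∀ γ w₁ w₂ : ℂ, γ ≠ 0 →
      let β : ℂ := γ⁻¹
      let v₁ : ℂ := γ⁻¹ * w₁
      let v₂ : ℂ := γ ^ 3 * w₂ + γ ^ 2 * w₁ ^ k + w₁ ^ 2
      let Z : ℂ := v₂
      let T : ℂ := β ^ 2 * v₂ - v₁ ^ 2
      let Y : ℂ := β * (Z ^ (k / 2) - T)
      let X : ℂ := v₁ * (Z ^ (k / 2) - T)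
      T = γ * w₂ + w₁ ^ k ∧
      Y = γ⁻¹ * (Z ^ (k / 2) - T) ∧
      X = γ⁻¹ * w₁ * (Z ^ (k / 2) - T) ∧
      X ^ 2 - Z * Y ^ 2 + T * (Z ^ (k / 2) - T) ^ 2 = 0 := by
  refine ⟨?_, ?_⟩
  · obtain ⟨m, rfl⟩ := hke
    have hm : (m + m) / 2 = m := by omega
    rw [hm]
    set g : MvPolynomial (Fin 3) ℂ := MvPolynomial.X 0
    set a : MvPolynomial (Fin 3) ℂ := MvPolynomial.X 1
    set b : MvPolynomial (Fin 3) ℂ := MvPolynomial.X 2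
    have hpow : g ∣ (g ^ 3 * b + g ^ 2 * a ^ (m + m) + a ^ 2) ^ m - (a ^ 2) ^ m :=
      Dvd.dvd.trans ⟨g ^ 2 * b + g * a ^ (m + m), by ring⟩ (sub_dvd_pow_sub_pow _ _ m)
    have hsplit : (g ^ 3 * b + g ^ 2 * a ^ (m + m) + a ^ 2) ^ m - (g * b + a ^ (m + m))
        = ((g ^ 3 * b + g ^ 2 * a ^ (m + m) + a ^ 2) ^ m - (a ^ 2) ^ m) - g * b := by
      rw [← pow_mul, two_mul]
      abel
    rw [hsplit]
    exact dvd_sub hpow (dvd_mul_right g b)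
  · intro γ w₁ w₂ hγ β v₁ v₂ Z T Y X
    refine ⟨?_, rfl, rfl, ?_⟩
    · simp only [T, β, v₁, v₂]
      field_simp
      ring
    · simp only [X, Y, T, Z]
      ring
end

section
/- Fix an odd integer k ≥ 1. For γ ∈ ℂ, γ ≠ 0 and w₁, w₂ ∈ ℂ, set β = γ⁻¹, v₁ = γ⁻¹w₁, v₂ = γ³w₂ + γ²w₁^k + w₁². Define Z = v₂, T = β²v₂ − v₁², Y = v₁·Z^{(k−1)/2} − β·T, X = β·Z^{(k+1)/2} − v₁·T. Then: (i) T = γw₂ + w₁^k; (ii) γ·Y = w₁·Z^{(k−1)/2} − T and γ·X = Z^{(k+1)/2} − w₁·T, and γ divides each of w₁Z^{(k−1)/2} − T and Z^{(k+1)/2} − w₁T as polynomials in ℂ[γ, w₁, w₂], so X and Y are regular in both coordinate charts; (iii) the relation X² − ZY² − T·(Z^k − T²) = 0 holds, the equation of the D_{k+2} (length 2) threefold singularity for k odd. -/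
/-- Modulo `g`, the polynomial `g³c + g²a^k + a²` agrees with `a²`, and so do their powers. -/
theorem dvd_pow_sub_sq_pow {R : Type*} [CommRing R] (g a c : R) (k n : ℕ) :
    g ∣ (g ^ 3 * c + g ^ 2 * a ^ k + a ^ 2) ^ n - (a ^ 2) ^ n :=
  dvd_trans ⟨g ^ 2 * c + g * a ^ k, by ring⟩ (sub_dvd_pow_sub_pow _ (a ^ 2) n)

/-- Blow-down of Ferrari's resolved geometry for the Intriligator–Wecht
`D_{k+2}` superpotential (`k` odd): the global holomorphic functions
`Z, T, Y, X` are regular in both charts (`γ` divides `w₁Z^{(k−1)/2} − T` and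
`Z^{(k+1)/2} − w₁T` as polynomials) and satisfy `X² − ZY² − T(Z^k − T²) = 0`,
the `D_{k+2}` (length 2) threefold singularity for `k` odd. -/
theorem stmt_6 (k : ℕ) (hk : 1 ≤ k) (hko : Odd k) :
    ((MvPolynomial.X 0 : MvPolynomial (Fin 3) ℂ) ∣
        MvPolynomial.X 1 *
            (MvPolynomial.X 0 ^ 3 * MvPolynomial.X 2
                + MvPolynomial.X 0 ^ 2 * MvPolynomial.X 1 ^ k
                + MvPolynomial.X 1 ^ 2) ^ ((k - 1) / 2)
          - (MvPolynomial.X 0 * MvPolynomial.X 2 + MvPolynomial.X 1 ^ k)) ∧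
    ((MvPolynomial.X 0 : MvPolynomial (Fin 3) ℂ) ∣
        (MvPolynomial.X 0 ^ 3 * MvPolynomial.X 2
              + MvPolynomial.X 0 ^ 2 * MvPolynomial.X 1 ^ k
              + MvPolynomial.X 1 ^ 2) ^ ((k + 1) / 2)
          - MvPolynomial.X 1 *
              (MvPolynomial.X 0 * MvPolynomial.X 2 + MvPolynomial.X 1 ^ k)) ∧
    ∀ γ w₁ w₂ : ℂ, γ ≠ 0 →
      let β : ℂ := γ⁻¹
      let v₁ : ℂ := γ⁻¹ * w₁
      let v₂ : ℂ := γ ^ 3 * w₂ + γ ^ 2 * w₁ ^ k + w₁ ^ 2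
      let Z : ℂ := v₂
      let T : ℂ := β ^ 2 * v₂ - v₁ ^ 2
      let Y : ℂ := v₁ * Z ^ ((k - 1) / 2) - β * T
      let X : ℂ := β * Z ^ ((k + 1) / 2) - v₁ * T
      T = γ * w₂ + w₁ ^ k ∧
      γ * Y = w₁ * Z ^ ((k - 1) / 2) - T ∧
      γ * X = Z ^ ((k + 1) / 2) - w₁ * T ∧
      X ^ 2 - Z * Y ^ 2 - T * (Z ^ k - T ^ 2) = 0 := by
  obtain ⟨m, rfl⟩ := hko
  have hm : (2 * m + 1 - 1) / 2 = m := by omega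
  have hm' : (2 * m + 1 + 1) / 2 = m + 1 := by omega
  rw [hm, hm']
  refine ⟨?_, ?_, ?_⟩
  · obtain ⟨q, hq⟩ := dvd_pow_sub_sq_pow (MvPolynomial.X 0 : MvPolynomial (Fin 3) ℂ)
      (MvPolynomial.X 1) (MvPolynomial.X 2) (2 * m + 1) m
    refine ⟨MvPolynomial.X 1 * q - MvPolynomial.X 2, ?_⟩
    rw [sub_eq_iff_eq_add.mp hq]
    ring
  · obtain ⟨q, hq⟩ := dvd_pow_sub_sq_pow (MvPolynomial.X 0 : MvPolynomial (Fin 3) ℂ)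
      (MvPolynomial.X 1) (MvPolynomial.X 2) (2 * m + 1) (m + 1)
    refine ⟨q - MvPolynomial.X 1 * MvPolynomial.X 2, ?_⟩
    rw [sub_eq_iff_eq_add.mp hq]
    ring
  · intro γ w₁ w₂ hγ β v₁ v₂ Z T Y X
    have hβ : γ * β = 1 := mul_inv_cancel₀ hγ
    have hv₁ : v₁ = β * w₁ := rfl
    have hZ : Z = γ ^ 3 * w₂ + γ ^ 2 * w₁ ^ (2 * m + 1) + w₁ ^ 2 := rfl
    have hT : T = β ^ 2 * Z - v₁ ^ 2 := rfl
    have hY : Y = v₁ * Z ^ m - β * T := rfl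
    have hX : X = β * Z ^ (m + 1) - v₁ * T := rfl
    clear_value X Y T Z v₂ v₁ β
    have hγT : γ ^ 2 * T = Z - w₁ ^ 2 := by
      rw [hT, hv₁]
      linear_combination (γ * β + 1) * (Z - w₁ ^ 2) * hβ
    have hγY : γ * Y = w₁ * Z ^ m - T := by
      rw [hY, hv₁]
      linear_combination (w₁ * Z ^ m - T) * hβ
    have hγX : γ * X = Z ^ (m + 1) - w₁ * T := by
      rw [hX, hv₁]
      linear_combination (Z ^ (m + 1) - w₁ * T) * hβ
    have hγ2 : γ ^ 2 ≠ 0 := pow_ne_zero 2 hγ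
    refine ⟨mul_left_cancel₀ hγ2 ?_, hγY, hγX, mul_left_cancel₀ hγ2 ?_⟩
    · rw [hγT, hZ]
      ring
    · calc γ ^ 2 * (X ^ 2 - Z * Y ^ 2 - T * (Z ^ (2 * m + 1) - T ^ 2))
          = (γ * X) ^ 2 - Z * (γ * Y) ^ 2 - γ ^ 2 * T * (Z ^ (2 * m + 1) - T ^ 2) := by ring
        _ = γ ^ 2 * 0 := by
          rw [hγX, hγY, hγT]
          ring
end

section
/- For γ ∈ ℂ, γ ≠ 0 and w₁, w₂ ∈ ℂ, set β = γ⁻¹, v₁ = γ⁻¹w₁, v₂ = γ³w₂ + γw₁³ + γ⁻¹w₁². Define X = βv₂ − v₁², Y = v₁v₂ − β²X, Z = v₂² − βv₁X, F = v₂³ − 2v₁³X + (β³ − 3v₁)X². Then: (i) X = γ²w₂ + w₁³ and Y = γ²w₁w₂ + w₁⁴ − w₂, and Z and F are likewise given by polynomials in (γ, w₁, w₂), so all four functions are regular in both coordinate charts; (ii) the relation F² − Z³ + X⁵ + 3X²YZ + XY³ = 0 holds, exhibiting the blow-down as the singular threefold X² − Y³ + Z⁵ + 3TYZ² + T³Z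 = 0 (after renaming variables), a Gorenstein threefold singularity of length 3. -/
/-- Blow-down of Ferrari's resolved geometry for the Intriligator–Wecht `E₇`
superpotential `W(x,y) = y³/3 + yx³`: the global holomorphic functions
`X, Y, Z, F` are regular in both charts (with `X = γ²w₂ + w₁³`,
`Y = γ²w₁w₂ + w₁⁴ − w₂`, and `Z, F` likewise polynomial in `(γ,w₁,w₂)`) and
satisfy `F² − Z³ + X⁵ + 3X²YZ + XY³ = 0`, the length 3 Gorenstein threefold
singularity `X² − Y³ + Z⁵ + 3TYZ² + T³Z = 0` after renaming variables. -/
theorem stmt_7 :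
    ∃ PZ PF : MvPolynomial (Fin 3) ℂ,
      ∀ γ w₁ w₂ : ℂ, γ ≠ 0 →
        let β : ℂ := γ⁻¹
        let v₁ : ℂ := γ⁻¹ * w₁
        let v₂ : ℂ := γ ^ 3 * w₂ + γ * w₁ ^ 3 + γ⁻¹ * w₁ ^ 2
        let X : ℂ := β * v₂ - v₁ ^ 2
        let Y : ℂ := v₁ * v₂ - β ^ 2 * X
        let Z : ℂ := v₂ ^ 2 - β * v₁ * X
        let F : ℂ := v₂ ^ 3 - 2 * v₁ ^ 3 * X + (β ^ 3 - 3 * v₁) * X ^ 2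
        X = γ ^ 2 * w₂ + w₁ ^ 3 ∧
        Y = γ ^ 2 * w₁ * w₂ + w₁ ^ 4 - w₂ ∧
        Z = MvPolynomial.eval ![γ, w₁, w₂] PZ ∧
        F = MvPolynomial.eval ![γ, w₁, w₂] PF ∧
        F ^ 2 - Z ^ 3 + X ^ 5 + 3 * X ^ 2 * Y * Z + X * Y ^ 3 = 0 := by
  let g : MvPolynomial (Fin 3) ℂ := MvPolynomial.X 0
  let a : MvPolynomial (Fin 3) ℂ := MvPolynomial.X 1
  let b : MvPolynomial (Fin 3) ℂ := MvPolynomial.X 2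
  let x : MvPolynomial (Fin 3) ℂ := g ^ 2 * b + a ^ 3
  refine ⟨g ^ 2 * x ^ 2 + 2 * a ^ 2 * x - a * b,
    g ^ 3 * x ^ 3 + 3 * g * a ^ 2 * x ^ 2 - 3 * g * a * b * x + g * b ^ 2, ?_⟩
  intro γ w₁ w₂ hγ β v₁ v₂ X Y Z F
  have hX : X = γ ^ 2 * w₂ + w₁ ^ 3 := by
    simp only [X, β, v₁, v₂]
    field_simp
    ring
  have hY : Y = γ ^ 2 * w₁ * w₂ + w₁ ^ 4 - w₂ := by
    simp only [Y, hX, β, v₁, v₂]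
    field_simp
    ring
  have hZ : Z = γ ^ 2 * (γ ^ 2 * w₂ + w₁ ^ 3) ^ 2
      + 2 * w₁ ^ 2 * (γ ^ 2 * w₂ + w₁ ^ 3) - w₁ * w₂ := by
    simp only [Z, hX, β, v₁, v₂]
    field_simp
    ring
  have hF : F = γ ^ 3 * (γ ^ 2 * w₂ + w₁ ^ 3) ^ 3
      + 3 * γ * w₁ ^ 2 * (γ ^ 2 * w₂ + w₁ ^ 3) ^ 2
      - 3 * γ * w₁ * w₂ * (γ ^ 2 * w₂ + w₁ ^ 3) + γ * w₂ ^ 2 := by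
    simp only [F, hX, β, v₁, v₂]
    field_simp
    ring
  refine ⟨hX, hY, ?_, ?_, ?_⟩
  · simp [hZ, g, a, b, x]
  · simp [hF, g, a, b, x]
  · rw [hF, hZ, hY, hX]
    ring
end

section
/- In the polynomial ring ℂ[β, v₁, v₂] define X = βv₂ − v₁², Y = v₁v₂ − β²X, Z = v₂² − βv₁X, and F = v₂³ − 2v₁³X + (β³ − 3v₁)X². Then the three identities β·F = Y² + XZ, v₁·F = X³ + YZ, and v₂·F = Z² − X²Y hold in ℂ[β, v₁, v₂]. -/
/-- Inversion of the blow-down for the Intriligator–Wecht `E₇` case: in the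
polynomial ring `ℂ[β, v₁, v₂]` (here `MvPolynomial (Fin 3) ℂ` with `β = X 0`,
`v₁ = X 1`, `v₂ = X 2`), the global holomorphic functions `X, Y, Z, F` satisfy
`β·F = Y² + XZ`, `v₁·F = X³ + YZ`, and `v₂·F = Z² − X²Y`. -/
theorem stmt_8 :
    let b : MvPolynomial (Fin 3) ℂ := MvPolynomial.X 0
    let v₁ : MvPolynomial (Fin 3) ℂ := MvPolynomial.X 1
    let v₂ : MvPolynomial (Fin 3) ℂ := MvPolynomial.X 2
    let X := b * v₂ - v₁ ^ 2
    let Y := v₁ * v₂ - b ^ 2 * X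
    let Z := v₂ ^ 2 - b * v₁ * X
    let F := v₂ ^ 3 - 2 * v₁ ^ 3 * X + (b ^ 3 - 3 * v₁) * X ^ 2
    b * F = Y ^ 2 + X * Z ∧ v₁ * F = X ^ 3 + Y * Z ∧ v₂ * F = Z ^ 2 - X ^ 2 * Y := by
  intro b v₁ v₂ X Y Z F
  refine ⟨?_, ?_, ?_⟩ <;> simp only [F, Z, Y, X] <;> ring
end

section
/- Let (X, Y, Z, F) ∈ ℂ⁴ with X ≠ 0. Then F = 0, Y² + XZ = 0 and X⁴ − Y³ = 0 hold simultaneously if and only if there exists t ∈ ℂ, t ≠ 0, such that (X, Y, Z, F) = (t³, t⁴, −t⁵, 0). -/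
/-- Parametrization of the locus `C` in the `E₇` blow-down: for `X ≠ 0`, the
equations `F = 0`, `Y² + XZ = 0`, `X⁴ − Y³ = 0` hold iff
`(X, Y, Z, F) = (t³, t⁴, −t⁵, 0)` for some nonzero `t ∈ ℂ`. -/
theorem stmt_9 (X Y Z F : ℂ) (hX : X ≠ 0) :
    (F = 0 ∧ Y ^ 2 + X * Z = 0 ∧ X ^ 4 - Y ^ 3 = 0) ↔
      ∃ t : ℂ, t ≠ 0 ∧ X = t ^ 3 ∧ Y = t ^ 4 ∧ Z = -t ^ 5 ∧ F = 0 := by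
  constructor
  · rintro ⟨hF, hYZ, hXY⟩
    obtain ⟨t, rfl⟩ : ∃ t, Y = X * t := ⟨Y / X, by field_simp⟩
    have hXt : X = t ^ 3 := mul_left_cancel₀ (pow_ne_zero 3 hX) (by linear_combination hXY)
    have hZ : Z = -(X * t ^ 2) := mul_left_cancel₀ hX (by linear_combination hYZ)
    subst hXt
    exact ⟨t, ne_zero_pow three_ne_zero hX, rfl, by ring, by rw [hZ]; ring, hF⟩
  · rintro ⟨t, -, rfl, rfl, rfl, hF⟩
    exact ⟨hF, by ring, by ring⟩
end

section
/- For γ ∈ ℂ, γ ≠ 0 and w₁, w₂ ∈ ℂ, set β = γ⁻¹, v₁ = γ⁻¹w₁, v₂ = γ³w₂ + γw₁². Define y₁ = v₂, y₂ = βv₂, y₃ = v₁v₂, y₄ = β³v₂ − v₁². Then y₁ = γ³w₂ + γw₁², y₂ = γ²w₂ + w₁², y₃ = γ²w₁w₂ + w₁³ and y₄ = w₂ (so all four functions are regular in both coordinate charts), and they satisfy the relation y₃² − y₂³ + y₁²y₄ = 0, the equation X² + Y²Z − T³ = 0 of the D̂ geometry (after renaming variables), a threefold with non-isolated singularities. 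-/
/-- Blow-down of Ferrari's resolved geometry for the Intriligator–Wecht `D̂`
superpotential `W(x,y) = xy²`: the global holomorphic functions `y₁,…,y₄` are
regular in both charts and satisfy `y₃² − y₂³ + y₁²y₄ = 0`, the equation
`X² + Y²Z − T³ = 0` of the `D̂` geometry (after renaming variables), a
threefold with non-isolated singularities. -/
theorem stmt_12 (γ w₁ w₂ : ℂ) (hγ : γ ≠ 0) :
    let β : ℂ := γ⁻¹
    let v₁ : ℂ := γ⁻¹ * w₁
    let v₂ : ℂ := γ ^ 3 * w₂ + γ * w₁ ^ 2
    let y₁ : ℂ := v₂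
    let y₂ : ℂ := β * v₂
    let y₃ : ℂ := v₁ * v₂
    let y₄ : ℂ := β ^ 3 * v₂ - v₁ ^ 2
    y₁ = γ ^ 3 * w₂ + γ * w₁ ^ 2 ∧ y₂ = γ ^ 2 * w₂ + w₁ ^ 2 ∧
    y₃ = γ ^ 2 * w₁ * w₂ + w₁ ^ 3 ∧ y₄ = w₂ ∧
    y₃ ^ 2 - y₂ ^ 3 + y₁ ^ 2 * y₄ = 0 := by
  intro β v₁ v₂ y₁ y₂ y₃ y₄
  have hy₂ : y₂ = γ ^ 2 * w₂ + w₁ ^ 2 := by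
    simp only [y₂, β, v₂]
    field_simp
  have hy₃ : y₃ = γ ^ 2 * w₁ * w₂ + w₁ ^ 3 := by
    simp only [y₃, v₁, v₂]
    field_simp
  have hy₄ : y₄ = w₂ := by
    simp only [y₄, β, v₁, v₂]
    field_simp
    ring
  refine ⟨rfl, hy₂, hy₃, hy₄, ?_⟩
  rw [hy₂, hy₃, hy₄]
  simp only [y₁, v₂]
  ring
end

section
/- Fix an integer k ≥ 1. For γ ∈ ℂ, γ ≠ 0 and w₁, w₂ ∈ ℂ, set β = γ⁻¹, v₁ = γ⁻¹w₁, v₂ = γ³w₂ + γ²w₁^k + w₁. There is a polynomial Q ∈ ℂ[γ, w₁, w₂] with γ·Q = (γ³w₂ + γ²w₁^k + w₁)^k − w₁^k. Define w̃₁ = w₁ + γ³w₂ + γ²w₁^k, w̃₂ = w₂ − Q, ṽ₁ = v₂, ṽ₂ = −v₁ + βv₂. Then ṽ₁ = w̃₁ and ṽ₂ = γ²·w̃₂ + γ·w̃₁^k. Hence the resolved geometry of the two-field Intriligator–Wecht A_k superpotential W(x,y) = x^{k+1}/(k+1) + y²/2 is, after this change of coordinates, identical to the resolved geometry (an O ⊕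 O(−2) bundle geometry) of the one-field superpotential W(x) = x^{k+1}/(k+1); the two superpotentials are geometrically equivalent. -/
/-- Geometric equivalence of the two-field Intriligator–Wecht `A_k`
superpotential `W(x,y) = x^{k+1}/(k+1) + y²/2` and the one-field superpotential
`W(x) = x^{k+1}/(k+1)`: after the change of coordinates
`w̃₁ = w₁ + γ³w₂ + γ²w₁^k`, `w̃₂ = w₂ − Q`, `ṽ₁ = v₂`, `ṽ₂ = −v₁ + βv₂`
(where `γ·Q = (γ³w₂+γ²w₁^k+w₁)^k − w₁^k`), the transition functions become
`ṽ₁ = w̃₁`, `ṽ₂ = γ²w̃₂ + γw̃₁^k`, those of the one-field `O ⊕ O(−2)` geometry. -/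
theorem stmt_15 (k : ℕ) (hk : 1 ≤ k) :
    ∃ Q : MvPolynomial (Fin 3) ℂ,
      (MvPolynomial.X 0 * Q
          = (MvPolynomial.X 0 ^ 3 * MvPolynomial.X 2
                + MvPolynomial.X 0 ^ 2 * MvPolynomial.X 1 ^ k + MvPolynomial.X 1) ^ k
              - MvPolynomial.X 1 ^ k) ∧
      ∀ γ w₁ w₂ : ℂ, γ ≠ 0 →
        let β : ℂ := γ⁻¹
        let v₁ : ℂ := γ⁻¹ * w₁
        let v₂ : ℂ := γ ^ 3 * w₂ + γ ^ 2 * w₁ ^ k + w₁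
        let w₁' : ℂ := w₁ + γ ^ 3 * w₂ + γ ^ 2 * w₁ ^ k
        let w₂' : ℂ := w₂ - MvPolynomial.eval ![γ, w₁, w₂] Q
        let v₁' : ℂ := v₂
        let v₂' : ℂ := -v₁ + β * v₂
        v₁' = w₁' ∧ v₂' = γ ^ 2 * w₂' + γ * w₁' ^ k := by
  open MvPolynomial in
  obtain ⟨Q, hQ⟩ : (X 0 : MvPolynomial (Fin 3) ℂ) ∣
      (X 0 ^ 3 * X 2 + X 0 ^ 2 * X 1 ^ k + X 1) ^ k - X 1 ^ k :=
    Dvd.dvd.trans ⟨X 0 ^ 2 * X 2 + X 0 * X 1 ^ k, by ring⟩ (sub_dvd_pow_sub_pow _ _ k)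
  refine ⟨Q, hQ.symm, fun γ w₁ w₂ hγ ↦ ⟨by ring, ?_⟩⟩
  have hQ_eval := congrArg (MvPolynomial.eval ![γ, w₁, w₂]) hQ
  simp only [map_sub, map_add, map_mul, map_pow, MvPolynomial.eval_X, Matrix.cons_val] at hQ_eval
  have h_sum : w₁ + γ ^ 3 * w₂ + γ ^ 2 * w₁ ^ k = γ ^ 3 * w₂ + γ ^ 2 * w₁ ^ k + w₁ := by ring
  rw [h_sum]
  have h_lhs : -(γ⁻¹ * w₁) + γ⁻¹ * (γ ^ 3 * w₂ + γ ^ 2 * w₁ ^ k + w₁)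
      = γ ^ 2 * w₂ + γ * w₁ ^ k := by
    field_simp
    ring
  rw [h_lhs]
  linear_combination -γ * hQ_eval
end

section
/- Let x, y ∈ ℂ. For γ ∈ ℂ, γ ≠ 0, set β = γ⁻¹, w₁(γ) = x + γy and w₂(γ) = (x³ + 3γx²y − (x+γy)³)/γ², which is the polynomial −3xy² − γy³ since γ² divides x³ + 3γx²y − (x+γy)³ in ℂ[γ]. Then: (i) the section in the β chart satisfies v₂(β) := β⁻³w₂(β⁻¹) + β⁻¹w₁(β⁻¹)³ + βw₁(β⁻¹)² = 3x²y·β⁻² + (x³ + y²)·β⁻¹ + 2xy + x²·β for all β ≠ 0; (ii) this function of β extends to a polynomial in β if and only if 3x²y = 0 and x³ + y² = 0, which holds if and only if x = y = 0; (iii) these two conditions are exactly the vanishing of the gradient of the Intriligator–Wecht E₇ superpotential W(x,y) = y³/3 + x³y. Hence the resolved E₇ geometry contains a single exceptional ℙ¹, located at the critical point of W. -/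
open Polynomial in
/-- A Laurent polynomial with lowest term of degree `-2` extends to a polynomial iff its
polar part vanishes. -/
theorem exists_polynomial_eq_laurent_iff {K : Type*} [Field K] [Infinite K] (a b c d : K) :
    (∃ p : K[X], ∀ t : K, t ≠ 0 → a * t⁻¹ ^ 2 + b * t⁻¹ + c + d * t = p.eval t) ↔
      a = 0 ∧ b = 0 := by
  constructor
  · rintro ⟨p, hp⟩
    have key : C a + C b * X = (p - C c - C d * X) * X ^ 2 := by
      refine eq_of_infinite_eval_eq _ _ ((Set.finite_singleton (0 : K)).infinite_compl.mono ?_)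
      intro t ht
      have ht0 : t ≠ 0 := ht
      simp only [Set.mem_ofPred_eq, eval_add, eval_sub, eval_mul, eval_C, eval_X, eval_pow,
        ← hp t ht0]
      field_simp
      ring
    have h₀ := congrArg (coeff · 0) key
    have h₁ := congrArg (coeff · 1) key
    simp only [coeff_mul_X_pow'] at h₀ h₁
    exact ⟨by simpa using h₀, by simpa [coeff_C] using h₁⟩
  · rintro ⟨rfl, rfl⟩
    exact ⟨C c + C d * X, fun t _ => by simp⟩

/-- Location of the exceptional `ℙ¹` in Ferrari's resolved geometry for the
Intriligator–Wecht `E₇` superpotential `W(x,y) = y³/3 + x³y`: with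
`w₁(γ) = x + γy` and `w₂(γ) = −3xy² − γy³` (the polynomial with
`γ²w₂(γ) = x³ + 3γx²y − (x+γy)³`), the `β`-chart section is
`v₂(β) = 3x²yβ⁻² + (x³+y²)β⁻¹ + 2xy + x²β`; it extends to a polynomial in `β`
iff `3x²y = 0` and `x³ + y² = 0`, iff `x = y = 0`, and these conditions are
exactly the vanishing of the gradient of `W`. -/
theorem stmt_16 (x y : ℂ) :
    let W : ℂ → ℂ → ℂ := fun a b => b ^ 3 / 3 + a ^ 3 * b
    let w₁ : ℂ → ℂ := fun γ => x + γ * y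
    let w₂ : ℂ → ℂ := fun γ => -3 * x * y ^ 2 - γ * y ^ 3
    let v₂ : ℂ → ℂ := fun β =>
      β⁻¹ ^ 3 * w₂ β⁻¹ + β⁻¹ * (w₁ β⁻¹) ^ 3 + β * (w₁ β⁻¹) ^ 2
    (∀ γ : ℂ, γ ≠ 0 → γ ^ 2 * w₂ γ = x ^ 3 + 3 * γ * x ^ 2 * y - (x + γ * y) ^ 3) ∧
    (∀ β : ℂ, β ≠ 0 →
      v₂ β = 3 * x ^ 2 * y * β⁻¹ ^ 2 + (x ^ 3 + y ^ 2) * β⁻¹ + 2 * x * y + x ^ 2 * β) ∧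
    ((∃ p : Polynomial ℂ, ∀ β : ℂ, β ≠ 0 → v₂ β = p.eval β) ↔
      (3 * x ^ 2 * y = 0 ∧ x ^ 3 + y ^ 2 = 0)) ∧
    ((3 * x ^ 2 * y = 0 ∧ x ^ 3 + y ^ 2 = 0) ↔ (x = 0 ∧ y = 0)) ∧
    (HasDerivAt (fun a => W a y) (3 * x ^ 2 * y) x ∧
      HasDerivAt (fun b => W x b) (y ^ 2 + x ^ 3) y) := by
  intro W w₁ w₂ v₂
  have hv : ∀ β : ℂ, β ≠ 0 →
      v₂ β = 3 * x ^ 2 * y * β⁻¹ ^ 2 + (x ^ 3 + y ^ 2) * β⁻¹ + 2 * x * y + x ^ 2 * β := by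
    intro β hβ
    simp only [v₂, w₁, w₂]
    field_simp
    ring
  refine ⟨fun γ _ => by simp only [w₂]; ring, hv, ?_, ?_, ?_, ?_⟩
  · rw [← exists_polynomial_eq_laurent_iff _ _ (2 * x * y) (x ^ 2)]
    exact exists_congr fun p => forall₂_congr fun β hβ => by rw [hv β hβ]
  · constructor
    · rintro ⟨h₁, h₂⟩
      rcases (by simpa using h₁ : x = 0 ∨ y = 0) with rfl | rfl
      · exact ⟨rfl, by simpa using h₂⟩
      · exact ⟨by simpa using h₂, rfl⟩
    · rintro ⟨rfl, rfl⟩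
      simp
  · simpa [W] using ((hasDerivAt_pow 3 x).mul_const y).const_add (y ^ 3 / 3)
  · have h := ((hasDerivAt_pow 3 y).div_const 3).add ((hasDerivAt_id y).const_mul (x ^ 3))
    have hd : y ^ 2 + x ^ 3 = ((3 : ℕ) : ℂ) * y ^ (3 - 1) / 3 + x ^ 3 * 1 := by
      push_cast
      ring
    rw [hd]
    exact h
end
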